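/- arXiv:math/0310079 — 2 statements merged into one kernel-verified Lean document; each statement's English description precedes it below -/
import Mathlib

section
/- For all n > 1, j(n) is even. -/
/-- A 01-partition: a finite sequence of non-negative integers whose last entry is ≥ 1,
satisfying the weakly decreasing conditions `n_j ≥ n_{j+1} - 1` and `n_j ≥ n_{j+2}`. -/
def Is01 (l : List ℕ) : Prop :=
  (∀ i, i + 1 < l.length → l[i + 1]! ≤ l[i]! + 1) ∧
  (∀ i, i + 2 < l.length → l[i + 2]! ≤ l[i]!) ∧
  (l ≠ [] → 1 ≤ l.getLast!)

/-- `j01 n` is the number of 01-partitions of `n` (with `j01 0 = 1`, the empty sequence). -/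
noncomputable def j01 (n : ℕ) : ℕ := Nat.card {l : List ℕ // Is01 l ∧ l.sum = n}

namespace Is01

theorem nil : Is01 [] := by simp [Is01]

theorem singleton_iff {x : ℕ} : Is01 [x] ↔ 1 ≤ x := by simp [Is01]

theorem pair_iff {x y : ℕ} : Is01 [x, y] ↔ y ≤ x + 1 ∧ 1 ≤ y := by
  simp [Is01]

theorem cons_cons_cons_iff {x y z : ℕ} {l : List ℕ} :
    Is01 (x :: y :: z :: l) ↔ y ≤ x + 1 ∧ z ≤ x ∧ Is01 (y :: z :: l) := by
  constructor
  · rintro ⟨h1, h2, h3⟩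
    refine ⟨by simpa using h1 0 (by simp), by simpa using h2 0 (by simp), fun i hi => ?_,
      fun i hi => ?_, fun _ => by simpa using h3 (by simp)⟩
    · simpa using h1 (i + 1) (by simpa using hi)
    · simpa using h2 (i + 1) (by simpa using hi)
  · rintro ⟨hy, hz, h1, h2, h3⟩
    refine ⟨fun i hi => ?_, fun i hi => ?_, fun _ => by simpa using h3 (by simp)⟩
    · cases i with
      | zero => simpa using hy
      | succ i => simpa using h1 i (by simpa using hi)
    · cases i with
      | zero => simpa using hz
      | succ i => simpa using h2 i (by simpa using hi)

theorem tail {x : ℕ} {l : List ℕ} (h : Is01 (x :: l)) : Is01 l := by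
  match l with
  | [] => exact nil
  | [y] => exact singleton_iff.2 (pair_iff.1 h).2
  | y :: z :: l => exact (cons_cons_cons_iff.1 h).2.2

theorem not_zero_zero (l : List ℕ) : ¬ Is01 (0 :: 0 :: l) := by
  induction l with
  | nil => simp [pair_iff]
  | cons z l ih =>
    intro h
    obtain ⟨-, hz, h⟩ := cons_cons_cons_iff.1 h
    obtain rfl : z = 0 := by omega
    exact ih h

theorem head_le {x y : ℕ} {l : List ℕ} (h : Is01 (x :: y :: l)) : y ≤ x + 1 := by
  cases l with
  | nil => exact (pair_iff.1 h).1
  | cons z l => exact (cons_cons_cons_iff.1 h).1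

theorem pos_of_ne {x y : ℕ} {l : List ℕ} (h : Is01 (x :: y :: l)) (hy : y ≠ x + 1) : 1 ≤ x := by
  by_contra hx
  have := h.head_le
  obtain rfl : x = 0 := by omega
  obtain rfl : y = 0 := by omega
  exact not_zero_zero l h

end Is01

/-- The block of entries with a given key: `2 * x` stands for the ascent `x, x + 1` and
`2 * x + 1` for the single entry `x + 1`. -/
def block (k : ℕ) : List ℕ := if k % 2 = 0 then [k / 2, k / 2 + 1] else [k / 2 + 1]

/-- The sum of the entries of `block k`. -/
def weight (k : ℕ) : ℕ := if k % 2 = 0 then k + 1 else k / 2 + 1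

/-- The keys of the blocks into which a sequence is cut by splitting off its ascents. -/
def blockKeys : List ℕ → List ℕ
  | [] => []
  | [x] => [2 * x - 1]
  | x :: y :: l => if y = x + 1 then 2 * x :: blockKeys l else (2 * x - 1) :: blockKeys (y :: l)

theorem sum_block (k : ℕ) : (block k).sum = weight k := by
  unfold block weight
  split_ifs
  · simp
    omega
  · simp

theorem sum_flatMap_block (ks : List ℕ) : (ks.flatMap block).sum = (ks.map weight).sum := by
  induction ks with
  | nil => rfl
  | cons k ks ih => simp [sum_block, ih]

theorem flatMap_block_blockKeys (l : List ℕ) (h : Is01 l) : (blockKeys l).flatMap block = l := by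
  induction l using blockKeys.induct with
  | case1 => rfl
  | case2 x =>
    have := Is01.singleton_iff.1 h
    simp only [blockKeys, List.flatMap_cons, List.flatMap_nil, block]
    rw [if_neg (by omega)]
    simp
    omega
  | case3 x l ih =>
    simp [blockKeys, block, ih h.tail.tail]
  | case4 x y l hy ih =>
    have := h.pos_of_ne hy
    simp only [blockKeys, if_neg hy, List.flatMap_cons, ih h.tail, block]
    rw [if_neg (by omega)]
    simp
    omega

theorem isChain_blockKeys (l : List ℕ) (h : Is01 l) : (blockKeys l).IsChain (· ≥ ·) := by
  induction l using blockKeys.induct with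
  | case1 => simp [blockKeys]
  | case2 x => simp [blockKeys]
  | case3 x l ih =>
    have ih := ih h.tail.tail
    match l with
    | [] => simp [blockKeys]
    | [z] =>
      have := Is01.cons_cons_cons_iff.1 h
      simp [blockKeys]
      omega
    | z :: w :: l =>
      have := Is01.cons_cons_cons_iff.1 h
      by_cases hw : w = z + 1
      · simp only [blockKeys, if_pos hw, if_true, List.isChain_cons_cons] at ih ⊢
        exact ⟨by omega, ih⟩
      · simp only [blockKeys, if_neg hw, if_true, List.isChain_cons_cons] at ih ⊢
        exact ⟨by omega, ih⟩
  | case4 x y l hy ih =>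
    have ih := ih h.tail
    have := h.head_le
    match l with
    | [] =>
      simp [blockKeys, hy]
      omega
    | z :: l =>
      have := Is01.cons_cons_cons_iff.1 h
      by_cases hz : z = y + 1
      · simp only [blockKeys, if_neg hy, if_pos hz, List.isChain_cons_cons] at ih ⊢
        exact ⟨by omega, ih⟩
      · simp only [blockKeys, if_neg hy, if_neg hz, List.isChain_cons_cons] at ih ⊢
        exact ⟨by omega, ih⟩

theorem block_two_mul (x : ℕ) : block (2 * x) = [x, x + 1] := by simp [block]

theorem block_two_mul_add_one (x : ℕ) : block (2 * x + 1) = [x + 1] := by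
  rw [block, if_neg (by omega)]
  simp
  omega

theorem is01_flatMap_block (ks : List ℕ) (h : ks.IsChain (· ≥ ·)) : Is01 (ks.flatMap block) := by
  induction ks with
  | nil => exact Is01.nil
  | cons k ks ih =>
    have ih := ih h.tail
    match ks with
    | [] =>
      obtain ⟨x, rfl | rfl⟩ := k.even_or_odd'
      · simp [block_two_mul, Is01.pair_iff]
      · simp [block_two_mul_add_one, Is01.singleton_iff]
    | [a] =>
      have hk := (List.isChain_cons_cons.1 h).1
      obtain ⟨x, rfl | rfl⟩ := k.even_or_odd' <;> obtain ⟨y, rfl | rfl⟩ := a.even_or_odd' <;>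
        simp [block_two_mul, block_two_mul_add_one, Is01.pair_iff, Is01.singleton_iff,
          Is01.cons_cons_cons_iff] at ih ⊢ <;> omega
    | a :: b :: ks =>
      have hk := (List.isChain_cons_cons.1 h).1
      have hab := (List.isChain_cons_cons.1 (List.isChain_cons_cons.1 h).2).1
      obtain ⟨x, rfl | rfl⟩ := k.even_or_odd' <;> obtain ⟨y, rfl | rfl⟩ := a.even_or_odd' <;>
        obtain ⟨z, rfl | rfl⟩ := b.even_or_odd' <;>
        simp [block_two_mul, block_two_mul_add_one,
          Is01.cons_cons_cons_iff] at ih ⊢ <;> simp [ih] <;> omega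

theorem blockKeys_flatMap_block (ks : List ℕ) (h : ks.IsChain (· ≥ ·)) :
    blockKeys (ks.flatMap block) = ks := by
  induction ks with
  | nil => rfl
  | cons k ks ih =>
    have ih := ih h.tail
    obtain ⟨x, rfl | rfl⟩ := k.even_or_odd'
    · simp [block_two_mul, blockKeys, ih]
    · match ks with
      | [] =>
        simp [block_two_mul_add_one, blockKeys]
        omega
      | a :: ks =>
        have hk := (List.isChain_cons_cons.1 h).1
        obtain ⟨y, rfl | rfl⟩ := a.even_or_odd'
        · simp only [List.flatMap_cons, block_two_mul, block_two_mul_add_one, List.cons_append,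
            List.nil_append] at ih ⊢
          rw [blockKeys, if_neg (by omega), ih]
          congr 1
        · simp only [List.flatMap_cons, block_two_mul_add_one, List.cons_append,
            List.nil_append] at ih ⊢
          rw [blockKeys, if_neg (by omega), ih]
          congr 1

/-- Multisets of keys of total weight `n`. -/
abbrev KeyMultiset (n : ℕ) : Type := {m : Multiset ℕ // (m.map weight).sum = n}

/-- A 01-partition is determined by the multiset of its blocks. -/
noncomputable def is01EquivKeyMultiset (n : ℕ) :
    {l : List ℕ // Is01 l ∧ l.sum = n} ≃ KeyMultiset n where
  toFun l := ⟨blockKeys l.1, by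
    rw [Multiset.map_coe, Multiset.sum_coe, ← sum_flatMap_block,
      flatMap_block_blockKeys _ l.2.1, l.2.2]⟩
  invFun m := ⟨(m.1.sort (· ≥ ·)).flatMap block,
    is01_flatMap_block _ (List.isChain_iff_pairwise.2 (m.1.pairwise_sort _)), by
      rw [sum_flatMap_block, ← Multiset.sum_coe, ← Multiset.map_coe, Multiset.sort_eq, m.2]⟩
  left_inv l := by
    apply Subtype.ext
    dsimp only
    rw [Multiset.coe_sort, List.mergeSort_eq_self, flatMap_block_blockKeys _ l.2.1]
    simpa using List.isChain_iff_pairwise.1 (isChain_blockKeys _ l.2.1)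
  right_inv m := by
    apply Subtype.ext
    dsimp only
    rw [blockKeys_flatMap_block _ (List.isChain_iff_pairwise.2 (m.1.pairwise_sort _)),
      Multiset.sort_eq]

theorem lt_two_mul_weight (k : ℕ) : k < 2 * weight k := by
  unfold weight
  split_ifs <;> omega

theorem one_le_weight (k : ℕ) : 1 ≤ weight k := by
  unfold weight
  split_ifs <;> omega

instance (n : ℕ) : Finite (KeyMultiset n) := by
  refine Set.Finite.subset (Finset.finite_toSet (Finset.Iic (n • (Multiset.range (2 * n))))) ?_
  intro m hm
  have hm : (m.map weight).sum = n := hm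
  simp only [Finset.coe_Iic, Set.mem_Iic]
  have hcard : m.card ≤ n := by
    have := Multiset.card_nsmul_le_sum (s := m.map weight) (a := 1)
      (by simpa using fun k _ => one_le_weight k)
    simpa [hm] using this
  rw [Multiset.le_iff_count]
  intro k
  by_cases hk : k ∈ m
  · have h1 : weight k ≤ n := hm ▸ Multiset.le_sum_of_mem (Multiset.mem_map_of_mem _ hk)
    have h2 := lt_two_mul_weight k
    have h3 : 1 ≤ (Multiset.range (2 * n)).count k :=
      Multiset.one_le_count_iff_mem.2 (Multiset.mem_range.2 (by omega))
    rw [Multiset.count_nsmul]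
    calc m.count k ≤ m.card := Multiset.count_le_card _ _
      _ ≤ n * 1 := by omega
      _ ≤ _ := Nat.mul_le_mul_left _ h3
  · simp [Multiset.count_eq_zero_of_notMem hk]

/-- The involution on keys exchanging the two kinds of blocks of each odd weight. -/
def swapKey (k : ℕ) : ℕ :=
  if k % 2 = 0 then 2 * k + 1 else if k % 4 = 1 then k / 2 else k

theorem swapKey_swapKey (k : ℕ) : swapKey (swapKey k) = k := by
  unfold swapKey
  split_ifs <;> omega

theorem weight_swapKey (k : ℕ) : weight (swapKey k) = weight k := by
  unfold swapKey weight
  split_ifs <;> omega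

theorem sum_map_weight_swapKey (m : Multiset ℕ) :
    ((m.map swapKey).map weight).sum = (m.map weight).sum := by
  simp [Multiset.map_map, weight_swapKey]

/-- The permutation of multisets of keys induced by `swapKey`. -/
def swapPerm (n : ℕ) : Equiv.Perm (KeyMultiset n) where
  toFun m := ⟨m.1.map swapKey, by rw [sum_map_weight_swapKey, m.2]⟩
  invFun m := ⟨m.1.map swapKey, by rw [sum_map_weight_swapKey, m.2]⟩
  left_inv m := by simp [Multiset.map_map, swapKey_swapKey]
  right_inv m := by simp [Multiset.map_map, swapKey_swapKey]

/-- A `swapKey`-invariant multiset of keys with twice the weight of `m`. -/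
def double (m : Multiset ℕ) : Multiset ℕ :=
  m.map (fun k => 2 * k + 1) + m.filter (fun k => k % 2 = 0)

/-- The inverse of `double` on `swapKey`-invariant multisets. -/
def halve (m : Multiset ℕ) : Multiset ℕ := (m.filter (fun k => k % 2 = 1)).map (· / 2)

theorem sum_map_weight_double (m : Multiset ℕ) :
    ((double m).map weight).sum = 2 * (m.map weight).sum := by
  induction m using Multiset.induction with
  | empty => simp [double]
  | cons k m ih =>
    have hk : weight (2 * k + 1) = k + 1 := by
      unfold weight
      split_ifs <;> omega
    by_cases h : k % 2 = 0
    · have : weight k = k + 1 := by simp [weight, h]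
      simp [double, h, hk] at ih ⊢
      omega
    · have : 2 * weight k = k + 1 := by
        simp [weight, h]
        omega
      simp [double, h, hk] at ih ⊢
      omega

theorem map_swapKey_double (m : Multiset ℕ) : (double m).map swapKey = double m := by
  induction m using Multiset.induction with
  | empty => simp [double]
  | cons k m ih =>
    by_cases h : k % 2 = 0
    · have h1 : swapKey (2 * k + 1) = k := by unfold swapKey; split_ifs <;> omega
      have h2 : swapKey k = 2 * k + 1 := by simp [swapKey, h]
      simp [double, h, h1, h2] at ih ⊢
      rw [ih, Multiset.cons_swap]
    · have h1 : swapKey (2 * k + 1) = 2 * k + 1 := by unfold swapKey; split_ifs <;> omega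
      simp [double, h, h1] at ih ⊢
      exact ih

theorem halve_double (m : Multiset ℕ) : halve (double m) = m := by
  induction m using Multiset.induction with
  | empty => simp [double, halve]
  | cons k m ih =>
    have h1 : (2 * k + 1) % 2 = 1 := by omega
    have h2 : (2 * k + 1) / 2 = k := by omega
    by_cases h : k % 2 = 0
    · simp [double, halve, h, h1, h2] at ih ⊢
      exact ih
    · simp [double, halve, h, h1, h2] at ih ⊢
      exact ih

theorem double_halve {m : Multiset ℕ} (hm : m.map swapKey = m) : double (halve m) = m := by
  have hodd : (halve m).map (fun k => 2 * k + 1) = m.filter (fun k => ¬ k % 2 = 0) := by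
    rw [halve, Multiset.map_map]
    conv_rhs => rw [← Multiset.map_id (Multiset.filter _ m)]
    rw [Multiset.filter_congr (q := fun k => ¬ k % 2 = 0) (by intros; omega)]
    refine Multiset.map_congr rfl fun k hk => ?_
    have := (Multiset.mem_filter.1 hk).2
    simp only [Function.comp, id]
    omega
  have heven : (halve m).filter (fun k => k % 2 = 0) = m.filter (fun k => k % 2 = 0) := by
    conv_rhs => rw [← hm]
    rw [halve, Multiset.filter_map, Multiset.filter_map, Multiset.filter_filter]
    have hiff : ∀ k, ((fun k => k % 2 = 0) ∘ swapKey) k ↔ k % 4 = 1 := by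
      intro k
      simp only [Function.comp, swapKey]
      split_ifs <;> omega
    rw [Multiset.filter_congr (q := fun k => k % 4 = 1)
        (by intro k _; simp only [Function.comp]; omega),
      Multiset.filter_congr (p := (fun k => k % 2 = 0) ∘ swapKey) (q := fun k => k % 4 = 1)
        (fun k _ => hiff k)]
    refine Multiset.map_congr rfl fun k hk => ?_
    have := (Multiset.mem_filter.1 hk).2
    unfold swapKey
    split_ifs <;> omega
  rw [double, hodd, heven, add_comm, Multiset.filter_add_not]

/-- The multisets fixed by `swapPerm (2 * n)` are the doubles of those of total weight `n`. -/
def fixedPointsEquiv (n : ℕ) :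
    Function.fixedPoints (swapPerm (2 * n)) ≃ KeyMultiset n where
  toFun m := ⟨halve m.1.1, by
    have h := sum_map_weight_double (halve m.1.1)
    rw [double_halve (congrArg Subtype.val m.2), m.1.2] at h
    omega⟩
  invFun m := ⟨⟨double m.1, by rw [sum_map_weight_double, m.2]⟩,
    Subtype.ext (map_swapKey_double m.1)⟩
  left_inv m := Subtype.ext (Subtype.ext (double_halve (congrArg Subtype.val m.2)))
  right_inv m := Subtype.ext (halve_double m.1)

theorem even_of_mem_fixedPoints {n : ℕ} {m : KeyMultiset n}
    (hm : m ∈ Function.fixedPoints (swapPerm n)) : 2 ∣ n := by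
  have h := sum_map_weight_double (halve m.1)
  rw [double_halve (congrArg Subtype.val hm), m.2] at h
  exact ⟨_, h⟩

theorem card_keyMultiset_modEq (n : ℕ) :
    Nat.card (KeyMultiset n) ≡ Nat.card (Function.fixedPoints (swapPerm n)) [MOD 2] := by
  classical
  have := Fintype.ofFinite (KeyMultiset n)
  rw [Nat.card_eq_fintype_card, Nat.card_eq_fintype_card]
  refine Equiv.Perm.card_fixedPoints_modEq (n := 1) ?_
  exact funext (swapPerm n).left_inv

theorem two_dvd_card_keyMultiset (n : ℕ) (hn : 0 < n) : 2 ∣ Nat.card (KeyMultiset n) := by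
  induction n using Nat.strong_induction_on with
  | _ n ih =>
    rw [(card_keyMultiset_modEq n).dvd_iff dvd_rfl]
    by_cases h : 2 ∣ n
    · obtain ⟨k, rfl⟩ := h
      rw [Nat.card_congr (fixedPointsEquiv k)]
      exact ih k (by omega) (by omega)
    · have : IsEmpty (Function.fixedPoints (swapPerm n)) :=
        ⟨fun m => h (even_of_mem_fixedPoints m.2)⟩
      simp

/-- `j(n)` is even for all `n > 1`. -/
theorem jagged_even (n : ℕ) (hn : 1 < n) : 2 ∣ j01 n := by
  rw [j01, Nat.card_congr (is01EquivKeyMultiset n)]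
  exact two_dvd_card_keyMultiset n (by omega)
end

section
/- If n cannot be written as a sum of p or fewer positive perfect squares, then 2^{p+1} divides j(n). -/
theorem is01_nil : Is01 [] := by simp [Is01]

theorem is01_cons {a : ℕ} {l : List ℕ} :
    Is01 (a :: l) ↔ Is01 l ∧ l[0]! ≤ a + 1 ∧ l[1]! ≤ a ∧ (l = [] → 1 ≤ a) := by
  rcases l with _ | ⟨b, l⟩
  · simp [Is01]
  · have hlast : (a :: b :: l).getLast! = (b :: l).getLast! := by
      simp [List.getLast!_eq_getLast?_getD]
    unfold Is01
    rw [hlast]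
    constructor
    · rintro ⟨h1, h2, h3⟩
      refine ⟨⟨fun i hi => ?_, fun i hi => ?_, fun _ => h3 (by simp)⟩, ?_, ?_, by simp⟩
      · simpa using h1 (i + 1) (by simpa using hi)
      · simpa using h2 (i + 1) (by simpa using hi)
      · simpa using h1 0 (by simp)
      · rcases l with _ | ⟨c, l⟩
        · simp
        · simpa using h2 0 (by simp)
    · rintro ⟨⟨h1, h2, h3⟩, h4, h5, -⟩
      refine ⟨fun i hi => ?_, fun i hi => ?_, fun _ => h3 (by simp)⟩
      · rcases i with _ | i
        · simpa using h4
        · simpa using h1 i (by simpa using hi)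
      · rcases i with _ | i
        · simpa using h5
        · simpa using h2 i (by simpa using hi)

/-- The 01-partitions of `n` all of whose blocks are at most `M`. Here a 01-partition is cut into
blocks `a`, of rank `2 * a`, and ascents `a, a + 1`, of rank `2 * a + 1`; the ranks decrease weakly,
so only the first block matters. -/
def boundedIs01 (M n : ℕ) : Set (List ℕ) :=
  {l | Is01 l ∧ 2 * l[0]! ≤ M ∧ 2 * l[1]! ≤ M + 1 ∧ l.sum = n}

/-- The sum of the entries of a block of rank `M`. -/
def blockWeight (M : ℕ) : ℕ := if Even M then M / 2 else M

/-- Prepend a block of rank `M`. -/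
def prependBlock (M : ℕ) (l : List ℕ) : List ℕ :=
  if Even M then (M / 2) :: l else (M / 2) :: (M / 2 + 1) :: l

theorem prependBlock_injective (M : ℕ) : Function.Injective (prependBlock M) := by
  intro l l' h
  unfold prependBlock at h
  split_ifs at h <;> simpa using h

theorem blockWeight_pos (M : ℕ) : 0 < blockWeight (M + 1) := by
  unfold blockWeight
  split_ifs with h
  · obtain ⟨k, hk⟩ := h
    omega
  · omega

theorem boundedIs01_zero (n : ℕ) : boundedIs01 0 n = if n = 0 then {[]} else ∅ := by
  have key : ∀ l : List ℕ, Is01 l → 2 * l[0]! ≤ 0 → 2 * l[1]! ≤ 1 → l = [] := by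
    intro l
    induction l with
    | nil => simp
    | cons a l ih =>
      intro h h0 h1
      rw [is01_cons] at h
      obtain ⟨h, h2, h3, h4⟩ := h
      have ha : a = 0 := by simpa using h0
      have hl : 2 * l[0]! ≤ 1 := by simpa using h1
      have := h4 (ih h (by omega) (by omega))
      exact absurd this (by omega)
  ext l
  constructor
  · rintro ⟨h, h0, h1, rfl⟩
    obtain rfl := key l h h0 h1
    simp
  · split_ifs with hn
    · rintro rfl
      exact ⟨is01_nil, by simp, by simp, by simp [hn]⟩
    · simp

theorem boundedIs01_succ (M n : ℕ) : boundedIs01 (M + 1) n = boundedIs01 M n ∪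
    if blockWeight (M + 1) ≤ n then
      prependBlock (M + 1) '' boundedIs01 (M + 1) (n - blockWeight (M + 1)) else ∅ := by
  ext l
  simp only [Set.mem_union, boundedIs01, Set.mem_ofPred_eq]
  rcases Nat.even_or_odd' (M + 1) with ⟨a, ha | ha⟩
  · have he : Even (M + 1) := ⟨a, by omega⟩
    have hd : (M + 1) / 2 = a := by omega
    have hp : prependBlock (M + 1) = fun l => a :: l := by
      funext l
      rw [prependBlock, if_pos he, hd]
    rw [hp, blockWeight, if_pos he, hd]
    constructor
    · rintro ⟨h, h0, h1, hs⟩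
      by_cases hl : 2 * l[0]! ≤ M
      · exact Or.inl ⟨h, hl, by omega, hs⟩
      right
      rcases l with _ | ⟨b, l⟩
      · simp at hl
      have hb : b = a := by simp at hl h0; omega
      subst hb
      rw [is01_cons] at h
      simp at hs h1
      rw [if_pos (by omega)]
      exact ⟨l, ⟨h.1, by simp; omega, by simp; have := h.2.2.1; simp at this; omega, by omega⟩, rfl⟩
    · rintro (⟨h, h0, h1, hs⟩ | h)
      · exact ⟨h, by omega, by omega, hs⟩
      · split_ifs at h with hw
        · obtain ⟨l, ⟨h, h0, h1, hs⟩, rfl⟩ := h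
          refine ⟨is01_cons.2 ⟨h, by omega, by omega, by omega⟩, by simp; omega, ?_, ?_⟩
          · simp at h0 ⊢; omega
          · simp; omega
        · simp at h
  · have he : ¬ Even (M + 1) := by rw [Nat.not_even_iff_odd]; exact ⟨a, ha⟩
    have hd : (M + 1) / 2 = a := by omega
    have hp : prependBlock (M + 1) = fun l => a :: (a + 1) :: l := by
      funext l
      rw [prependBlock, if_neg he, hd]
    rw [hp, blockWeight, if_neg he]
    constructor
    · rintro ⟨h, h0, h1, hs⟩
      by_cases hl : 2 * l[1]! ≤ M + 1
      · exact Or.inl ⟨h, by omega, hl, hs⟩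
      right
      rcases l with _ | ⟨b, _ | ⟨c, l⟩⟩
      · simp at hl
      · simp at hl
      rw [is01_cons, is01_cons] at h
      obtain ⟨⟨h, h2, h3, -⟩, h4, h5, -⟩ := h
      simp at hl h0 h1 h2 h3 h4 h5 hs
      obtain rfl : b = a := by omega
      obtain rfl : c = b + 1 := by omega
      rw [if_pos (by omega)]
      exact ⟨l, ⟨h, by simp; omega, by simp; omega, by omega⟩, rfl⟩
    · rintro (⟨h, h0, h1, hs⟩ | h)
      · exact ⟨h, by omega, by omega, hs⟩
      · split_ifs at h with hw
        · obtain ⟨l, ⟨h, h0, h1, hs⟩, rfl⟩ := h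
          refine ⟨is01_cons.2 ⟨is01_cons.2 ⟨h, by omega, by omega, by omega⟩, ?_, ?_, ?_⟩,
            ?_, ?_, ?_⟩
          · simp
          · simp at h0 ⊢; omega
          · simp
          · simp; omega
          · simp; omega
          · simp; omega
        · simp at h

theorem disjoint_boundedIs01_prependBlock (M n : ℕ) (s : Set (List ℕ)) :
    Disjoint (boundedIs01 M n) (prependBlock (M + 1) '' s) := by
  rw [Set.disjoint_left]
  rintro _ ⟨-, h0, h1, -⟩ ⟨l, -, rfl⟩
  unfold prependBlock at h0 h1
  split_ifs at h0 h1 with he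
  · obtain ⟨k, hk⟩ := he
    simp at h0
    omega
  · obtain ⟨k, hk⟩ := Nat.not_even_iff_odd.1 he
    simp at h1
    omega

theorem finite_boundedIs01 (M n : ℕ) : (boundedIs01 M n).Finite := by
  induction M generalizing n with
  | zero =>
    rw [boundedIs01_zero]
    split_ifs <;> simp
  | succ M ih =>
    induction n using Nat.strong_induction_on with
    | _ n ihn =>
      rw [boundedIs01_succ]
      refine (ih n).union ?_
      split_ifs with hw
      · have := blockWeight_pos M
        exact (ihn _ (by omega)).image _
      · simp

theorem ncard_boundedIs01_succ (M n : ℕ) : (boundedIs01 (M + 1) n).ncard =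
    (boundedIs01 M n).ncard + if blockWeight (M + 1) ≤ n then
      (boundedIs01 (M + 1) (n - blockWeight (M + 1))).ncard else 0 := by
  rw [boundedIs01_succ]
  split_ifs with hw
  · rw [Set.ncard_union_eq (disjoint_boundedIs01_prependBlock _ _ _) (finite_boundedIs01 _ _)
      ((finite_boundedIs01 _ _).image _), Set.ncard_image_of_injective _ (prependBlock_injective _)]
  · simp

theorem j01_eq_ncard_boundedIs01 (n : ℕ) : j01 n = (boundedIs01 (2 * n) n).ncard := by
  have hle : ∀ (l : List ℕ) (i : ℕ), l[i]! ≤ l.sum := by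
    intro l i
    by_cases hi : i < l.length
    · rw [getElem!_pos l i hi]
      exact List.single_le_sum (by simp) _ (List.getElem_mem hi)
    · rw [getElem!_neg l i hi]
      exact Nat.zero_le _
  rw [j01, ← Set.coe_ofPred, Nat.card_coe_set_eq]
  congr 1
  ext l
  simp only [boundedIs01, Set.mem_ofPred_eq]
  constructor
  · rintro ⟨h, rfl⟩
    have h0 := hle l 0
    have h1 := hle l 1
    exact ⟨h, by omega, by omega, rfl⟩
  · rintro ⟨h, -, -, hs⟩
    exact ⟨h, hs⟩

open PowerSeries in
/-- The generating function of 01-partitions with blocks of rank at most `M`. -/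
noncomputable def boundedGenFun (M : ℕ) : PowerSeries ℤ :=
  PowerSeries.mk fun n => ((boundedIs01 M n).ncard : ℤ)

open PowerSeries in
theorem boundedGenFun_zero : boundedGenFun 0 = 1 := by
  ext n
  rw [boundedGenFun, coeff_mk, boundedIs01_zero, coeff_one]
  split_ifs <;> simp

open PowerSeries in
theorem boundedGenFun_succ_mul (M : ℕ) :
    boundedGenFun (M + 1) * (1 - X ^ blockWeight (M + 1)) = boundedGenFun M := by
  ext n
  rw [mul_sub, mul_one, map_sub, coeff_mul_X_pow']
  simp only [boundedGenFun, coeff_mk]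
  rw [ncard_boundedIs01_succ]
  split_ifs <;> simp

open PowerSeries in
theorem boundedGenFun_mul_prod (M : ℕ) :
    boundedGenFun M * ∏ i ∈ Finset.range M, (1 - X ^ blockWeight (i + 1)) = 1 := by
  induction M with
  | zero => simp [boundedGenFun_zero]
  | succ M ih =>
    rw [Finset.prod_range_succ, mul_comm (∏ i ∈ _, _), ← mul_assoc, boundedGenFun_succ_mul, ih]

open PowerSeries in
theorem prod_blockWeight (N : ℕ) :
    ∏ i ∈ Finset.range (2 * N), (1 - X ^ blockWeight (i + 1) : PowerSeries ℤ) =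
      (∏ i ∈ Finset.range N, (1 - X ^ (2 * i + 1))) * ∏ i ∈ Finset.range N, (1 - X ^ (i + 1)) := by
  induction N with
  | zero => simp
  | succ N ih =>
    have h1 : blockWeight (2 * N + 1) = 2 * N + 1 := by
      rw [blockWeight, if_neg (by simp [parity_simps])]
    have h2 : blockWeight (2 * N + 1 + 1) = N + 1 := by
      rw [blockWeight, if_pos (by simp [parity_simps])]
      omega
    rw [Nat.mul_succ, Finset.prod_range_succ, Finset.prod_range_succ, ih, Finset.prod_range_succ,
      Finset.prod_range_succ, h1, h2]
    ring

section GaussianBinomial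

variable {R : Type*} [CommRing R]

/-- The Gaussian binomial coefficient `[m, k]` at `Q`. -/
def gaussianBinom (Q : R) : ℕ → ℕ → R
  | _, 0 => 1
  | 0, _ + 1 => 0
  | m + 1, k + 1 => gaussianBinom Q m k + Q ^ (k + 1) * gaussianBinom Q m (k + 1)

/-- The `q`-Pochhammer symbol `(Q; Q)_m`. -/
def qFactorial (Q : R) (m : ℕ) : R := ∏ i ∈ Finset.range m, (1 - Q ^ (i + 1))

theorem gaussianBinom_zero_right (Q : R) (m : ℕ) : gaussianBinom Q m 0 = 1 := by
  cases m <;> rfl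

theorem gaussianBinom_of_lt (Q : R) {m k : ℕ} (h : m < k) : gaussianBinom Q m k = 0 := by
  induction m generalizing k with
  | zero =>
    obtain ⟨k, rfl⟩ := Nat.exists_eq_succ_of_ne_zero h.ne'
    rfl
  | succ m ih =>
    obtain ⟨k, rfl⟩ := Nat.exists_eq_succ_of_ne_zero (Nat.ne_zero_of_lt h)
    rw [gaussianBinom, ih (by omega), ih (by omega), mul_zero, add_zero]

theorem qFactorial_succ (Q : R) (m : ℕ) :
    qFactorial Q (m + 1) = qFactorial Q m * (1 - Q ^ (m + 1)) :=
  Finset.prod_range_succ _ _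

theorem gaussianBinom_mul_qFactorial (Q : R) (a b : ℕ) :
    gaussianBinom Q (a + b) a * qFactorial Q a * qFactorial Q b = qFactorial Q (a + b) := by
  induction h : a + b generalizing a b with
  | zero =>
    obtain ⟨rfl, rfl⟩ : a = 0 ∧ b = 0 := by omega
    simp [gaussianBinom, qFactorial]
  | succ m ih =>
    rcases a with _ | a
    · obtain rfl : b = m + 1 := by omega
      simp [gaussianBinom_zero_right, qFactorial]
    rcases b with _ | b
    · obtain rfl : a = m := by omega
      have h1 := ih a 0 (by omega)
      rw [gaussianBinom, gaussianBinom_of_lt Q (Nat.lt_succ_self a), qFactorial_succ]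
      linear_combination (1 - Q ^ (a + 1)) * h1
    · have h1 := ih a (b + 1) (by omega)
      have h2 := ih (a + 1) b (by omega)
      obtain rfl : m = a + b + 1 := by omega
      rw [gaussianBinom, qFactorial_succ Q (a + b + 1)]
      rw [qFactorial_succ] at h1 h2 ⊢
      rw [qFactorial_succ]
      linear_combination (1 - Q ^ (a + 1)) * h1 + Q ^ (a + 1) * (1 - Q ^ (b + 1)) * h2

/-- The `q`-binomial theorem, in homogeneous form. -/
theorem prod_add_mul_pow (Q x y : R) (m : ℕ) :
    ∏ i ∈ Finset.range m, (y + x * Q ^ i) = ∑ k ∈ Finset.range (m + 1),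
      gaussianBinom Q m k * Q ^ (k * (k - 1) / 2) * x ^ k * y ^ (m - k) := by
  induction m generalizing x with
  | zero => simp [gaussianBinom]
  | succ m ih =>
    have hshift : ∀ i ∈ Finset.range m, y + x * Q ^ (i + 1) = y + (x * Q) * Q ^ i := by
      intro i _
      ring
    rw [Finset.prod_range_succ', Finset.prod_congr rfl hshift, ih, pow_zero, mul_one, mul_add,
      Finset.sum_range_succ' _ (m + 1)]
    have hexp : ∀ k : ℕ, (k + 1) * (k + 1 - 1) / 2 = k * (k - 1) / 2 + k := by
      intro k
      rw [← Finset.sum_range_id_mul_two (k + 1), ← Finset.sum_range_id_mul_two k,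
        Nat.mul_div_cancel _ two_pos, Nat.mul_div_cancel _ two_pos, Finset.sum_range_succ]
    have hsplit : ∀ k ∈ Finset.range (m + 1),
        gaussianBinom Q (m + 1) (k + 1) * Q ^ ((k + 1) * (k + 1 - 1) / 2) * x ^ (k + 1) *
          y ^ (m + 1 - (k + 1)) =
        gaussianBinom Q m k * Q ^ (k * (k - 1) / 2) * (x * Q) ^ k * y ^ (m - k) * x +
        gaussianBinom Q m (k + 1) * Q ^ ((k + 1) * (k + 1 - 1) / 2) * (x * Q) ^ (k + 1) *
          y ^ (m - k) := by
      intro k _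
      rw [gaussianBinom, hexp, Nat.add_sub_add_right, mul_pow, mul_pow]
      ring
    have htail : (∑ k ∈ Finset.range (m + 1), gaussianBinom Q m (k + 1) *
        Q ^ ((k + 1) * (k + 1 - 1) / 2) * (x * Q) ^ (k + 1) * y ^ (m - k)) + y ^ (m + 1) =
        (∑ k ∈ Finset.range (m + 1),
          gaussianBinom Q m k * Q ^ (k * (k - 1) / 2) * (x * Q) ^ k * y ^ (m - k)) * y := by
      rw [Finset.sum_range_succ, gaussianBinom_of_lt Q (Nat.lt_succ_self m),
        Finset.sum_range_succ' _ m, add_mul (∑ k ∈ _, _), Finset.sum_mul]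
      have hy : ∀ k ∈ Finset.range m,
          gaussianBinom Q m (k + 1) * Q ^ ((k + 1) * (k + 1 - 1) / 2) * (x * Q) ^ (k + 1) *
            y ^ (m - (k + 1)) * y =
          gaussianBinom Q m (k + 1) * Q ^ ((k + 1) * (k + 1 - 1) / 2) * (x * Q) ^ (k + 1) *
            y ^ (m - k) := by
        intro k hk
        have : m - k = m - (k + 1) + 1 := by
          have := Finset.mem_range.1 hk
          omega
        rw [this, pow_succ]
        ring
      rw [Finset.sum_congr rfl hy]
      simp [gaussianBinom_zero_right, pow_succ]
    rw [Finset.sum_congr rfl hsplit, Finset.sum_add_distrib, ← Finset.sum_mul, ← htail]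
    simp [gaussianBinom_zero_right]
    ring

theorem pow_succ_dvd_qFactorial_sub (Q : R) {m n : ℕ} (h : m ≤ n) :
    Q ^ (m + 1) ∣ qFactorial Q n - qFactorial Q m := by
  induction n, h using Nat.le_induction with
  | base => simp
  | succ n hmn ih =>
    have h1 : qFactorial Q (n + 1) - qFactorial Q m =
        (qFactorial Q n - qFactorial Q m) - Q ^ (n + 1) * qFactorial Q n := by
      rw [qFactorial_succ]
      ring
    rw [h1]
    exact dvd_sub ih ((pow_dvd_pow Q (by omega)).mul_right _)

theorem pow_succ_dvd_qFactorial_mul_gaussianBinom_sub_one (Q : R) {a b c m : ℕ}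
    (ha : m ≤ a) (hb : m ≤ b) (hc : m ≤ c) (hu : IsUnit (qFactorial Q m)) :
    Q ^ (m + 1) ∣ qFactorial Q c * gaussianBinom Q (a + b) a - 1 := by
  obtain ⟨v, hv⟩ := hu.exists_right_inv
  obtain ⟨α, hα⟩ := pow_succ_dvd_qFactorial_sub Q ha
  obtain ⟨β, hβ⟩ := pow_succ_dvd_qFactorial_sub Q hb
  obtain ⟨γ, hγ⟩ := pow_succ_dvd_qFactorial_sub Q hc
  obtain ⟨δ, hδ⟩ := pow_succ_dvd_qFactorial_sub Q (ha.trans (Nat.le_add_right a b))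
  have h := gaussianBinom_mul_qFactorial Q a b
  rw [sub_eq_iff_eq_add] at hα hβ hγ hδ
  rw [hα, hβ, hδ] at h
  rw [hγ]
  set u := qFactorial Q m
  set g := gaussianBinom Q (a + b) a
  set t := Q ^ (m + 1)
  refine ⟨γ * g + v * (δ - g * (u * α + u * β + t * α * β)), ?_⟩
  linear_combination v * h + (1 - g * u) * hv

end GaussianBinomial

section Gauss

open PowerSeries

theorem isUnit_qFactorial_X_sq (m : ℕ) : IsUnit (qFactorial (X ^ 2 : PowerSeries ℤ) m) := by
  rw [isUnit_iff_constantCoeff, qFactorial, map_prod]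
  simp

theorem prod_X_pow_sub (M : ℕ) :
    ∏ i ∈ Finset.range (2 * (M + 1)), (X ^ (2 * M + 1) + (-1) * (X ^ 2) ^ i : PowerSeries ℤ) =
      (-1) ^ (M + 1) * X ^ ((M + 1) * (3 * M + 1)) *
        (∏ i ∈ Finset.range (M + 1), (1 - X ^ (2 * i + 1))) ^ 2 := by
  have hlow : ∏ i ∈ Finset.range (M + 1),
      (X ^ (2 * M + 1) + (-1) * (X ^ 2) ^ i : PowerSeries ℤ) =
      (-1) ^ (M + 1) * X ^ ((M + 1) * M) * ∏ i ∈ Finset.range (M + 1), (1 - X ^ (2 * i + 1)) := by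
    have h1 : ∀ i ∈ Finset.range (M + 1),
        (X ^ (2 * M + 1) + (-1) * (X ^ 2) ^ (M + 1 - 1 - i) : PowerSeries ℤ) =
        (-1) * ((X ^ 2) ^ (M + 1 - 1 - i) * (1 - X ^ (2 * i + 1))) := by
      intro i hi
      have hi := Finset.mem_range.1 hi
      have h2 : (X ^ (2 * M + 1) : PowerSeries ℤ) = (X ^ 2) ^ (M + 1 - 1 - i) * X ^ (2 * i + 1) := by
        rw [← pow_mul, ← pow_add]
        congr 1
        omega
      rw [h2]
      ring
    rw [← Finset.prod_range_reflect, Finset.prod_congr rfl h1, Finset.prod_mul_distrib,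
      Finset.prod_mul_distrib, Finset.prod_range_reflect (fun i => (X ^ 2 : PowerSeries ℤ) ^ i),
      Finset.prod_pow_eq_pow_sum, ← pow_mul, mul_comm 2, Finset.sum_range_id_mul_two,
      Finset.prod_const, Finset.card_range, Nat.add_sub_cancel, mul_assoc]
  have hhigh : ∏ i ∈ Finset.range (M + 1),
      (X ^ (2 * M + 1) + (-1) * (X ^ 2) ^ (M + 1 + i) : PowerSeries ℤ) =
      X ^ ((2 * M + 1) * (M + 1)) * ∏ i ∈ Finset.range (M + 1), (1 - X ^ (2 * i + 1)) := by
    have h1 : ∀ i ∈ Finset.range (M + 1),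
        (X ^ (2 * M + 1) + (-1) * (X ^ 2) ^ (M + 1 + i) : PowerSeries ℤ) =
        X ^ (2 * M + 1) * (1 - X ^ (2 * i + 1)) := by
      intro i _
      ring
    rw [Finset.prod_congr rfl h1, Finset.prod_mul_distrib, Finset.prod_const, Finset.card_range,
      ← pow_mul]
  rw [two_mul (M + 1), Finset.prod_range_add, hlow, hhigh]
  ring

/-- A finite form of the Jacobi triple product identity at `z = -1`. -/
theorem sq_prod_eq_sum_gaussianBinom {N : ℕ} (hN : 0 < N) :
    (∏ i ∈ Finset.range N, (1 - X ^ (2 * i + 1) : PowerSeries ℤ)) ^ 2 =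
      ∑ k ∈ Finset.range (2 * N + 1),
        gaussianBinom (X ^ 2) (2 * N) k * ((-1) ^ (N + k) * X ^ (((k - N) + (N - k)) ^ 2)) := by
  obtain ⟨M, rfl⟩ := Nat.exists_eq_succ_of_ne_zero hN.ne'
  have h := (prod_X_pow_sub M).symm.trans (prod_add_mul_pow (X ^ 2) (-1) (X ^ (2 * M + 1)) _)
  have hterm : ∀ k ∈ Finset.range (2 * (M + 1) + 1),
      gaussianBinom (X ^ 2 : PowerSeries ℤ) (2 * (M + 1)) k * (X ^ 2) ^ (k * (k - 1) / 2) *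
        (-1) ^ k * (X ^ (2 * M + 1)) ^ (2 * (M + 1) - k) =
      (-1) ^ (M + 1) * X ^ ((M + 1) * (3 * M + 1)) * (gaussianBinom (X ^ 2) (2 * (M + 1)) k *
        ((-1) ^ (M + 1 + k) * X ^ (((k - (M + 1)) + (M + 1 - k)) ^ 2))) := by
    intro k hk
    have hk := Finset.mem_range.1 hk
    have hexp : k * (k - 1) + (2 * M + 1) * (2 * (M + 1) - k) =
        (M + 1) * (3 * M + 1) + ((k - (M + 1)) + (M + 1 - k)) ^ 2 := by
      obtain ⟨b, hb⟩ : ∃ b, b + k = 2 * (M + 1) := ⟨2 * (M + 1) - k, by omega⟩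
      have hb' : 2 * (M + 1) - k = b := by omega
      have hkk : k * (k - 1) + k = k * k := by
        rcases k with _ | k
        · rfl
        · simp only [Nat.add_sub_cancel]
          ring
      have hd : ((k - (M + 1) + (M + 1 - k) : ℕ) : ℤ) ^ 2 = ((k : ℤ) - (M + 1)) ^ 2 := by
        rcases le_total k (M + 1) with h | h
        · rw [Nat.sub_eq_zero_of_le h, zero_add, Nat.cast_sub h]
          push_cast
          ring
        · rw [Nat.sub_eq_zero_of_le h, add_zero, Nat.cast_sub h]
          push_cast
          ring
      rw [hb']
      have hkk' : ((k * (k - 1) : ℕ) : ℤ) + k = k * k := by exact_mod_cast hkk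
      have hbk' : (b : ℤ) + k = 2 * (M + 1) := by exact_mod_cast hb
      have : ((k * (k - 1) + (2 * M + 1) * b : ℕ) : ℤ) =
          (((M + 1) * (3 * M + 1) + ((k - (M + 1)) + (M + 1 - k)) ^ 2 : ℕ) : ℤ) := by
        rw [Nat.cast_add, Nat.cast_add, Nat.cast_pow, hd]
        push_cast at hkk' ⊢
        linear_combination hkk' + (2 * M + 1) * hbk'
      exact_mod_cast this
    have hX : (X ^ 2 : PowerSeries ℤ) ^ (k * (k - 1) / 2) *
        (X ^ (2 * M + 1)) ^ (2 * (M + 1) - k) =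
        X ^ ((M + 1) * (3 * M + 1)) * X ^ (((k - (M + 1)) + (M + 1 - k)) ^ 2) := by
      rw [← pow_mul, ← pow_mul, ← pow_add, ← pow_add,
        Nat.two_mul_div_two_of_even (Nat.even_mul_pred_self k), hexp]
    have hsign : ((-1) ^ (M + 1) * (-1) ^ (M + 1) : PowerSeries ℤ) = 1 := by
      rw [← mul_pow]
      simp
    rw [pow_add (-1 : PowerSeries ℤ) (M + 1) k]
    linear_combination gaussianBinom (X ^ 2) (2 * (M + 1)) k * (-1) ^ k * hX -
      gaussianBinom (X ^ 2) (2 * (M + 1)) k * (-1) ^ k * X ^ ((M + 1) * (3 * M + 1)) *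
        X ^ (((k - (M + 1)) + (M + 1 - k)) ^ 2) * hsign
  rw [Finset.sum_congr rfl hterm, ← Finset.mul_sum] at h
  exact mul_left_cancel₀ (mul_ne_zero (pow_ne_zero _ (by simp)) (pow_ne_zero _ X_ne_zero)) h

/-- The sum `∑ (-1)^j X^(j^2)` over `1 ≤ j ≤ N`. -/
noncomputable def altSquareSum (N : ℕ) : PowerSeries ℤ :=
  ∑ j ∈ Finset.range N, (-1) ^ (j + 1) * X ^ ((j + 1) ^ 2)

theorem sum_range_eq_altSquareSum (N : ℕ) :
    ∑ k ∈ Finset.range (2 * N + 1), ((-1) ^ (N + k) * X ^ (((k - N) + (N - k)) ^ 2) :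
      PowerSeries ℤ) = 1 + 2 * altSquareSum N := by
  have hlow : ∑ k ∈ Finset.range N, ((-1) ^ (N + k) * X ^ (((k - N) + (N - k)) ^ 2) :
      PowerSeries ℤ) = altSquareSum N := by
    rw [← Finset.sum_range_reflect, altSquareSum]
    refine Finset.sum_congr rfl fun j hj => ?_
    have hj := Finset.mem_range.1 hj
    have h1 : N - 1 - j - N + (N - (N - 1 - j)) = j + 1 := by omega
    have h2 : N + (N - 1 - j) = 2 * (N - 1 - j) + (j + 1) := by omega
    rw [h1, h2, pow_add, pow_mul]
    simp
  have hhigh : ∑ k ∈ Finset.range N, ((-1) ^ (N + (N + (k + 1))) *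
      X ^ (((N + (k + 1) - N) + (N - (N + (k + 1)))) ^ 2) : PowerSeries ℤ) = altSquareSum N := by
    refine Finset.sum_congr rfl fun j _ => ?_
    have h1 : N + (j + 1) - N + (N - (N + (j + 1))) = j + 1 := by omega
    rw [h1, ← add_assoc N N, ← two_mul, pow_add, pow_mul]
    simp
  rw [two_mul N, add_assoc, Finset.sum_range_add, Finset.sum_range_succ', hlow, hhigh, add_zero,
    ← two_mul N, pow_mul]
  simp
  ring

theorem pow_succ_dvd_sq_prod_mul_sub {N : ℕ} (hN : 0 < N) :
    (X : PowerSeries ℤ) ^ (N + 1) ∣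
      qFactorial (X ^ 2) N * (∏ i ∈ Finset.range N, (1 - X ^ (2 * i + 1))) ^ 2 -
        (1 + 2 * altSquareSum N) := by
  rw [sq_prod_eq_sum_gaussianBinom hN, ← sum_range_eq_altSquareSum, Finset.mul_sum,
    ← Finset.sum_sub_distrib]
  refine Finset.dvd_sum fun k hk => ?_
  have hk := Finset.mem_range.1 hk
  obtain ⟨b, hb⟩ : ∃ b, 2 * N = k + b := ⟨2 * N - k, by omega⟩
  set d := (k - N) + (N - k) with hd
  have h := pow_succ_dvd_qFactorial_mul_gaussianBinom_sub_one (X ^ 2 : PowerSeries ℤ)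
    (a := k) (b := b) (c := N) (m := N - d) (by omega) (by omega) (by omega)
    (isUnit_qFactorial_X_sq _)
  rw [← hb, ← pow_mul] at h
  have hle : N + 1 ≤ 2 * (N - d + 1) + d ^ 2 := by
    have : N - d + d = N := by omega
    nlinarith [sq_nonneg ((d : ℤ) - 1)]
  have h2 : qFactorial (X ^ 2 : PowerSeries ℤ) N * (gaussianBinom (X ^ 2) (2 * N) k *
      ((-1) ^ (N + k) * X ^ d ^ 2)) - (-1) ^ (N + k) * X ^ d ^ 2 =
      (qFactorial (X ^ 2) N * gaussianBinom (X ^ 2) (2 * N) k - 1) * X ^ d ^ 2 *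
        (-1) ^ (N + k) := by
    ring
  rw [h2]
  refine Dvd.dvd.mul_right ((pow_dvd_pow X hle).trans ?_) _
  rw [pow_add]
  exact mul_dvd_mul_right h _

theorem qFactorial_two_mul {R : Type*} [CommRing R] (x : R) (N : ℕ) :
    qFactorial x (2 * N) =
      qFactorial (x ^ 2) N * ∏ i ∈ Finset.range N, (1 - x ^ (2 * i + 1)) := by
  induction N with
  | zero => simp [qFactorial]
  | succ N ih =>
    rw [Nat.mul_succ, qFactorial_succ, qFactorial_succ, ih, qFactorial_succ, Finset.prod_range_succ,
      ← pow_mul]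
    ring

/-- Gauss's identity `∏ (1 - q^k) / (1 + q^k) = ∑ (-1)^j q^(j^2)`, truncated at degree `N`. -/
theorem pow_succ_dvd_prod_mul_qFactorial_sub {N : ℕ} (hN : 0 < N) :
    (X : PowerSeries ℤ) ^ (N + 1) ∣
      (∏ i ∈ Finset.range N, (1 - X ^ (2 * i + 1))) * qFactorial X N -
        (1 + 2 * altSquareSum N) := by
  have h1 := pow_succ_dvd_sq_prod_mul_sub hN
  have h2 := pow_succ_dvd_qFactorial_sub (X : PowerSeries ℤ) (show N ≤ 2 * N by omega)
  rw [qFactorial_two_mul] at h2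
  convert dvd_sub h1 (h2.mul_left (∏ i ∈ Finset.range N, (1 - X ^ (2 * i + 1)))) using 1
  ring

end Gauss

open PowerSeries in
theorem exists_sum_sq_of_coeff_altSquareSum_pow_ne_zero (N j n : ℕ)
    (h : coeff n (altSquareSum N ^ j) ≠ 0) : ∃ f : Fin j → ℕ, ∑ i, f i ^ 2 = n := by
  induction j generalizing n with
  | zero =>
    rw [pow_zero, coeff_one] at h
    exact ⟨Fin.elim0, by simp_all⟩
  | succ j ih =>
    rw [pow_succ', coeff_mul] at h
    obtain ⟨⟨a, b⟩, hab, h⟩ := Finset.exists_ne_zero_of_sum_ne_zero h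
    rw [Finset.HasAntidiagonal.mem_antidiagonal] at hab
    obtain ⟨f, hf⟩ := ih b (right_ne_zero_of_mul h)
    have ha := left_ne_zero_of_mul h
    rw [altSquareSum, map_sum] at ha
    obtain ⟨c, -, hc⟩ := Finset.exists_ne_zero_of_sum_ne_zero ha
    rw [coeff_mul_X_pow'] at hc
    have hac : a = (c + 1) ^ 2 := by
      by_contra hne
      apply hc
      split_ifs with hle
      · have h1 : ((-1) ^ (c + 1) : PowerSeries ℤ) = C ((-1) ^ (c + 1)) := by simp
        rw [h1, coeff_C, if_neg (by omega)]
      · rfl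
    refine ⟨Fin.cons (c + 1) f, ?_⟩
    rw [Fin.sum_univ_succ]
    simp only [Fin.cons_zero, Fin.cons_succ]
    rw [hf, ← hac]
    exact hab

theorem exists_sum_sq_of_le {j p n : ℕ} (hjp : j ≤ p)
    (h : ∃ f : Fin j → ℕ, ∑ i, f i ^ 2 = n) : ∃ f : Fin p → ℕ, ∑ i, f i ^ 2 = n := by
  induction p, hjp using Nat.le_induction with
  | base => exact h
  | succ p _ ih =>
    obtain ⟨f, hf⟩ := ih
    exact ⟨Fin.cons 0 f, by simp [Fin.sum_univ_succ, hf]⟩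

/-- If `n` cannot be written as a sum of `p` or fewer positive squares,
then `2^(p+1)` divides `j(n)`. -/
theorem jagged_cong_pow_two (p n : ℕ) (hp : 0 < p) (hn : 0 < n)
    (h : ¬ ∃ f : Fin p → ℕ, ∑ i, (f i) ^ 2 = n) :
    2 ^ (p + 1) ∣ j01 n := by
  open PowerSeries in
  have hJ := boundedGenFun_mul_prod (2 * n)
  rw [prod_blockWeight] at hJ
  set J := boundedGenFun (2 * n) with hJdef
  set T := altSquareSum n with hT
  obtain ⟨W, hW⟩ := pow_succ_dvd_prod_mul_qFactorial_sub hn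
  rw [qFactorial] at hW
  have hgeom : (∑ j ∈ Finset.range (p + 1), (-2 * T) ^ j) * (1 + 2 * T) =
      1 - (-2 * T) ^ (p + 1) := by
    have := geom_sum_mul_neg (-2 * T) (p + 1)
    rw [← this]
    ring
  have hsplit : J = ∑ j ∈ Finset.range (p + 1), (-2 * T) ^ j +
      C ((-2) ^ (p + 1)) * (T ^ (p + 1) * J) -
      X ^ (n + 1) * (W * J * ∑ j ∈ Finset.range (p + 1), (-2 * T) ^ j) := by
    have hC : (C ((-2) ^ (p + 1)) : PowerSeries ℤ) * T ^ (p + 1) = (-2 * T) ^ (p + 1) := by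
      rw [mul_pow]
      simp
    rw [← mul_assoc, hC]
    linear_combination (∑ j ∈ Finset.range (p + 1), (-2 * T) ^ j) * hJ - J * hgeom -
      (∑ j ∈ Finset.range (p + 1), (-2 * T) ^ j) * J * hW
  have hzero : coeff n (∑ j ∈ Finset.range (p + 1), (-2 * T) ^ j) = 0 := by
    rw [map_sum]
    refine Finset.sum_eq_zero fun j hj => ?_
    have hC : (-2 * T) ^ j = C ((-2) ^ j) * T ^ j := by
      rw [mul_pow]
      simp
    rw [hC, coeff_C_mul]
    by_contra hne
    exact h (exists_sum_sq_of_le (Nat.lt_succ_iff.1 (Finset.mem_range.1 hj))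
      (exists_sum_sq_of_coeff_altSquareSum_pow_ne_zero n j n (right_ne_zero_of_mul hne)))
  have hcoeff := congrArg (coeff n) hsplit
  rw [map_sub, map_add, hzero, coeff_C_mul, coeff_X_pow_mul', if_neg (by omega), zero_add, sub_zero,
    hJdef, boundedGenFun, coeff_mk, ← j01_eq_ncard_boundedIs01] at hcoeff
  have hdvd : ((-2) ^ (p + 1) : ℤ) ∣ (j01 n : ℤ) := ⟨_, hcoeff⟩
  rw [neg_pow, (isUnit_one.neg.pow (p + 1)).mul_left_dvd] at hdvd
  exact_mod_cast hdvd
end
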